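/- arXiv:1608.04578 — 2 statements merged into one kernel-verified Lean document; each statement's English description precedes it below -/
import Mathlib

section
/- Let d ≥ 3. For every 0 ≤ j ≤ d − 1 and all x, y ∈ U_{j+1} = ℕ₀^{j+1} × ℤ^{d−j−1}, the strict inequality G_j(x, y) < G_{j+1}(x, y) holds. In particular, for all x, y in the orthant O = ℕ₀^d one has the strict chain g(x, y) < G_1(x, y) < G_2(x, y) < … < G_d(x, y) = G_O(x, y). -/
open scoped ENNReal
open Filter

noncomputable section

variable {V : Type*}

/-- Total conductance (weight) `π(x) = Σ_y c(x,y)` at a vertex `x`. -/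
def piW (c : V → V → ℝ≥0∞) (x : V) : ℝ≥0∞ := ∑' y, c x y

/-- One-step transition probability `c(x,y)/π(x)` of the random walk with conductances `c`. -/
def step (c : V → V → ℝ≥0∞) (x y : V) : ℝ≥0∞ := c x y / piW c x

/-- `n`-step transition probability of the random walk with conductances `c`. -/
def stepN [DecidableEq V] (c : V → V → ℝ≥0∞) : ℕ → V → V → ℝ≥0∞
  | 0, x, y => if x = y then 1 else 0
  | n + 1, x, y => ∑' z, stepN c n x z * step c z y

/-- Green's function `G(x,y) = π(y)⁻¹ Σ_n p_n(x,y)` of the walk with conductances `c`. -/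
def green [DecidableEq V] (c : V → V → ℝ≥0∞) (x y : V) : ℝ≥0∞ :=
  (piW c y)⁻¹ * ∑' n, stepN c n x y

/-- Nearest-neighbour adjacency on `ℤ^d`. -/
def latAdj {d : ℕ} (x y : Fin d → ℤ) : Prop := (∑ i, (x i - y i).natAbs) = 1

instance {d : ℕ} (x y : Fin d → ℤ) : Decidable (latAdj x y) := by
  unfold latAdj; infer_instance

/-- Unit conductances on `ℤ^d`. -/
def cZ (d : ℕ) (x y : Fin d → ℤ) : ℝ≥0∞ := if latAdj x y then 1 else 0

/-- Green's function of the simple random walk on `ℤ^d`. -/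
def g (d : ℕ) : (Fin d → ℤ) → (Fin d → ℤ) → ℝ≥0∞ := green (cZ d)

/-- Membership in `U_m = ℕ₀^m × ℤ^{d-m}`: the first `m` coordinates are nonnegative. -/
def memU (m : ℕ) {d : ℕ} (x : Fin d → ℤ) : Prop := ∀ i : Fin d, (i : ℕ) < m → 0 ≤ x i

instance (m : ℕ) {d : ℕ} (x : Fin d → ℤ) : Decidable (memU m x) := by
  unfold memU; infer_instance

/-- Unit conductances on the subgraph `U_m` of `ℤ^d`. -/
def cU (d m : ℕ) (x y : Fin d → ℤ) : ℝ≥0∞ :=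
  if memU m x ∧ memU m y ∧ latAdj x y then 1 else 0

/-- Green's function `G_m` of the simple random walk on `U_m = ℕ₀^m × ℤ^{d-m}`. -/
def Gm (d m : ℕ) : (Fin d → ℤ) → (Fin d → ℤ) → ℝ≥0∞ := green (cU d m)

/-- Reflection in the first coordinate: `ȳ = (-y₁, y₂, …, y_d)`. -/
def reflFirst {d : ℕ} (y : Fin d → ℤ) : Fin d → ℤ := fun i => if (i : ℕ) = 0 then -y i else y i

/-- The first standard basis vector of `ℤ^d`. -/
def e1 (d : ℕ) : Fin d → ℤ := fun i => if (i : ℕ) = 0 then 1 else 0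


/-- The forward equation for the Green's function, in divergence form. -/
lemma tsum_stepN_eq [DecidableEq V] (c : V → V → ℝ≥0∞) (x z : V) :
    ∑' n, stepN c n x z = (if x = z then 1 else 0) + ∑' w, green c x w * c w z := by
  rw [tsum_eq_zero_add' ENNReal.summable]
  congr 1
  simp only [stepN]
  rw [ENNReal.tsum_comm]
  refine tsum_congr fun w => ?_
  rw [ENNReal.tsum_mul_right, green, step, div_eq_mul_inv]
  ring

/-- A supersolution with two unit sources dominates the sum of the two Green's functions. -/
lemma green_add_green_le [DecidableEq V] (c : V → V → ℝ≥0∞) (x x' : V) (h : V → ℝ≥0∞)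
    (hh : ∀ z, (if x = z then 1 else 0) + (if x' = z then 1 else 0) + ∑' w, h w * c w z
      ≤ piW c z * h z) (y : V) :
    green c x y + green c x' y ≤ h y := by
  have key : ∀ N z, ∑ n ∈ Finset.range N, (stepN c n x z + stepN c n x' z) ≤ piW c z * h z := by
    intro N
    induction N with
    | zero => simp
    | succ N ih =>
      intro z
      refine le_trans ?_ (hh z)
      rw [Finset.sum_range_succ', add_comm]
      refine add_le_add le_rfl ?_
      simp only [stepN]
      calc ∑ n ∈ Finset.range N, (∑' w, stepN c n x w * step c w z + ∑' w, stepN c n x' w * step c w z)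
          = ∑' w, (∑ n ∈ Finset.range N, (stepN c n x w + stepN c n x' w)) * step c w z := by
            simp only [← ENNReal.tsum_add, ← add_mul]
            rw [← Summable.tsum_finsetSum fun _ _ => ENNReal.summable]
            simp only [Finset.sum_mul]
        _ ≤ ∑' w, h w * c w z := by
            refine ENNReal.tsum_le_tsum fun w => ?_
            calc _ ≤ piW c w * h w * step c w z := mul_le_mul_left (ih w) _
              _ = piW c w * (piW c w)⁻¹ * (h w * c w z) := by
                  rw [step, div_eq_mul_inv]; ring
              _ ≤ 1 * (h w * c w z) := mul_le_mul_left (ENNReal.mul_inv_le_one _) _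
              _ = _ := one_mul _
  calc green c x y + green c x' y
      = (piW c y)⁻¹ * ∑' n, (stepN c n x y + stepN c n x' y) := by
        rw [ENNReal.tsum_add, mul_add, green, green]
    _ ≤ (piW c y)⁻¹ * (piW c y * h y) := by
        refine mul_le_mul_right ?_ _
        exact ENNReal.summable.tsum_le_of_sum_range_le fun N => key N y
    _ = (piW c y)⁻¹ * piW c y * h y := by ring
    _ ≤ 1 * h y := mul_le_mul_left (by rw [mul_comm]; exact ENNReal.mul_inv_le_one _) _
    _ = h y := one_mul _

lemma latAdj_iff {d : ℕ} (w z : Fin d → ℤ) :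
    latAdj w z ↔ ∃ p : Fin d × ℤˣ, Function.update z p.1 (z p.1 + p.2) = w := by
  unfold latAdj
  constructor
  · intro h
    obtain ⟨i, -, hi⟩ : ∃ i ∈ Finset.univ, (w i - z i).natAbs ≠ 0 := by
      by_contra! hc
      rw [Finset.sum_eq_zero hc] at h
      exact absurd h (by norm_num)
    rw [← Finset.add_sum_erase _ _ (Finset.mem_univ i)] at h
    have h0 : ∑ k ∈ Finset.univ.erase i, (w k - z k).natAbs = 0 := by omega
    have h1 : (w i - z i).natAbs = 1 := by omega
    have hs : IsUnit (w i - z i) := Int.isUnit_iff_natAbs_eq.2 h1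
    refine ⟨(i, hs.unit), ?_⟩
    ext k
    by_cases hk : k = i
    · subst hk; simp
    · have := Finset.sum_eq_zero_iff.1 h0 k (by simp [hk])
      simp [hk]; omega
  · rintro ⟨⟨i, s⟩, rfl⟩
    rw [Finset.sum_eq_single i]
    · simp
    · intro k _ hk; simp [hk]
    · simp

lemma latAdj_comm {d : ℕ} (w z : Fin d → ℤ) : latAdj w z ↔ latAdj z w := by
  unfold latAdj
  simp only [← Int.natAbs_neg (w _ - z _), neg_sub]

lemma cU_comm {d : ℕ} (m : ℕ) (w z : Fin d → ℤ) : cU d m w z = cU d m z w := by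
  unfold cU
  simp only [latAdj_comm w z, and_left_comm]

lemma piW_cU {d : ℕ} (m : ℕ) (z : Fin d → ℤ) : piW (cU d m) z = ∑' w, cU d m w z :=
  tsum_congr fun _ => cU_comm _ _ _

/-- The neighbour of `z` in direction `p`, where steps leaving `U_m` are replaced by loops. -/
def nbr {d : ℕ} (m : ℕ) (z : Fin d → ℤ) (p : Fin d × ℤˣ) : Fin d → ℤ :=
  Function.update z p.1 (if (p.1 : ℕ) < m then max (z p.1 + p.2) 0 else z p.1 + p.2)

lemma update_injective {d : ℕ} (z : Fin d → ℤ) :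
    Function.Injective fun p : Fin d × ℤˣ => Function.update z p.1 (z p.1 + p.2) := by
  rintro ⟨i, s⟩ ⟨k, t⟩ h
  have hs : (s : ℤ) ≠ 0 := s.ne_zero
  have h1 := congrFun h i
  by_cases hik : i = k
  · subst hik
    simp at h1
    simp [Units.ext_iff, h1]
  · simp [hik] at h1

lemma memU_update {d m : ℕ} {z : Fin d → ℤ} (hz : memU m z) (i : Fin d) (a : ℤ) :
    memU m (Function.update z i a) ↔ ((i : ℕ) < m → 0 ≤ a) := by
  constructor
  · intro h hi
    simpa using h i hi
  · intro h k hk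
    by_cases hki : k = i
    · subst hki; simpa using h hk
    · simpa [hki] using hz k hk

lemma nbr_eq {d m : ℕ} {z : Fin d → ℤ} (hz : memU m z) (p : Fin d × ℤˣ) :
    nbr m z p = if memU m (Function.update z p.1 (z p.1 + p.2)) then
      Function.update z p.1 (z p.1 + p.2) else z := by
  rw [nbr]
  simp only [memU_update hz]
  obtain ⟨i, s⟩ := p
  by_cases hi : (i : ℕ) < m
  · have := hz i hi
    simp only [hi, if_true, forall_const]
    split_ifs with h
    · rw [max_eq_left h]
    · have h2 : (s : ℤ) = -1 := by
        rcases Int.units_eq_one_or s with rfl | rfl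
        · simp at h; omega
        · simp
      have : max (z i + s) 0 = z i := by omega
      rw [this, Function.update_eq_self]
  · simp [hi]

/-- Restoring the missing edges as loops adds a multiple of the value at the vertex. -/
lemma exists_sum_nbr_eq {d m : ℕ} {z : Fin d → ℤ} (hz : memU m z) :
    ∃ k : ℝ≥0∞, k ≠ ⊤ ∧ ∀ h : (Fin d → ℤ) → ℝ≥0∞,
      ∑ p, h (nbr m z p) = ∑' w, h w * cU d m w z + k * h z := by
  refine ⟨∑ p : Fin d × ℤˣ, if memU m (Function.update z p.1 (z p.1 + p.2)) then 0 else 1,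
    ?_, fun h => ?_⟩
  · refine ENNReal.sum_ne_top.2 fun p _ => ?_
    split_ifs <;> simp
  · rw [← (update_injective z).tsum_eq, tsum_fintype, Finset.sum_mul, ← Finset.sum_add_distrib]
    · refine Finset.sum_congr rfl fun p _ => ?_
      have : latAdj (Function.update z p.1 (z p.1 + p.2)) z := (latAdj_iff _ _).2 ⟨p, rfl⟩
      rw [nbr_eq hz, cU]
      split_ifs <;> simp_all
    · intro w hw
      rw [Function.mem_support] at hw
      have : latAdj w z := by
        by_contra hc
        simp [cU, hc] at hw
      exact (latAdj_iff _ _).1 this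

lemma piW_cU_ne_zero {d m : ℕ} (hd : 0 < d) {z : Fin d → ℤ} (hz : memU m z) :
    piW (cU d m) z ≠ 0 := by
  let w := Function.update z ⟨0, hd⟩ (z ⟨0, hd⟩ + 1)
  have hw : latAdj w z := (latAdj_iff _ _).2 ⟨(⟨0, hd⟩, 1), by simp [w]⟩
  have hm : memU m w := (memU_update hz _ _).2 fun h => by have := hz _ h; omega
  rw [piW_cU]
  intro h
  have := ENNReal.tsum_eq_zero.1 h w
  simp [cU, hw, hm, hz] at this

lemma piW_cU_add {d m : ℕ} {z : Fin d → ℤ} {k : ℝ≥0∞}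
    (hk : ∀ h : (Fin d → ℤ) → ℝ≥0∞,
      ∑ p, h (nbr m z p) = ∑' w, h w * cU d m w z + k * h z) :
    piW (cU d m) z + k = 2 * d := by
  have := hk fun _ => 1
  simp only [one_mul, mul_one, ← piW_cU] at this
  rw [← this]
  simp [mul_comm]

lemma piW_cU_ne_top {d m : ℕ} {z : Fin d → ℤ} (hz : memU m z) : piW (cU d m) z ≠ ⊤ := by
  obtain ⟨k, -, hk⟩ := exists_sum_nbr_eq hz
  intro h
  have := piW_cU_add hk
  rw [h, top_add] at this
  exact ENNReal.mul_ne_top (by simp) (by simp) this.symm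

lemma piW_mul_Gm {d m : ℕ} (hd : 0 < d) (x : Fin d → ℤ) {z : Fin d → ℤ} (hz : memU m z) :
    piW (cU d m) z * Gm d m x z =
      (if x = z then 1 else 0) + ∑' w, Gm d m x w * cU d m w z := by
  rw [Gm, green, ← mul_assoc, ENNReal.mul_inv_cancel (piW_cU_ne_zero hd hz) (piW_cU_ne_top hz),
    one_mul, tsum_stepN_eq]

lemma sum_nbr_Gm {d m : ℕ} (hd : 0 < d) (x : Fin d → ℤ) {z : Fin d → ℤ} (hz : memU m z) :
    (if x = z then 1 else 0) + ∑ p, Gm d m x (nbr m z p) = 2 * d * Gm d m x z := by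
  obtain ⟨k, -, hk⟩ := exists_sum_nbr_eq hz
  rw [hk, ← piW_cU_add hk, add_mul, piW_mul_Gm hd x hz, add_assoc]

/-- Comparison principle for the walk with loops, where every vertex has weight `2d`. -/
lemma Gm_add_Gm_le {d m : ℕ} (hd : 0 < d) {x x' : Fin d → ℤ} (hx : memU m x) (hx' : memU m x')
    (h : (Fin d → ℤ) → ℝ≥0∞)
    (hh : ∀ z, memU m z → (if x = z then 1 else 0) + (if x' = z then 1 else 0) +
      ∑ p, h (nbr m z p) ≤ 2 * d * h z) (y : Fin d → ℤ) :
    Gm d m x y + Gm d m x' y ≤ h y := by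
  refine green_add_green_le _ _ _ _ (fun z => ?_) y
  by_cases hz : memU m z
  · by_cases ht : h z = ⊤
    · rw [ht, ENNReal.mul_top (piW_cU_ne_zero hd hz)]; exact le_top
    obtain ⟨k, hk, hk'⟩ := exists_sum_nbr_eq hz
    have := hh z hz
    rw [hk', ← piW_cU_add hk', add_mul, ← add_assoc] at this
    exact (ENNReal.add_le_add_iff_right (ENNReal.mul_ne_top hk ht)).1 this
  · have h1 : x ≠ z := by rintro rfl; exact hz hx
    have h2 : x' ≠ z := by rintro rfl; exact hz hx'
    simp [cU, hz, h1, h2]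

lemma Gm_ne_zero {d m : ℕ} (hd : 0 < d) {x : Fin d → ℤ} (hx : memU m x) (n : ℕ) :
    ∀ y, memU m y → ∑ i, (x i - y i).natAbs = n → Gm d m x y ≠ 0 := by
  induction n with
  | zero =>
    intro y hy hn h0
    have hxy : x = y := by
      ext i
      have := Finset.sum_eq_zero_iff.1 hn i (Finset.mem_univ i)
      omega
    subst hxy
    have := piW_mul_Gm hd x hy
    rw [h0, mul_zero, if_pos rfl, eq_comm, add_eq_zero] at this
    exact one_ne_zero this.1
  | succ n ih =>
    intro y hy hn h0
    obtain ⟨i, -, hi⟩ : ∃ i ∈ Finset.univ, (x i - y i).natAbs ≠ 0 := by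
      by_contra! hc
      rw [Finset.sum_eq_zero hc] at hn
      omega
    obtain ⟨s, hs⟩ : ∃ s : ℤˣ, (x i - y i).natAbs = (x i - (y i + s)).natAbs + 1 := by
      rcases lt_or_ge (x i) (y i) with hlt | hge
      · exact ⟨-1, by simp; omega⟩
      · exact ⟨1, by simp; omega⟩
    set w := Function.update y i (y i + s) with hw
    have hwU : memU m w := (memU_update hy _ _).2 fun h => by
      have h1 := hy i h
      have h2 := hx i h
      rcases Int.units_eq_one_or s with rfl | rfl <;> simp at hs ⊢ <;> omega
    have hadj : latAdj w y := (latAdj_iff _ _).2 ⟨(i, s), rfl⟩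
    refine ih w hwU ?_ ?_
    · rw [← Finset.add_sum_erase _ _ (Finset.mem_univ i)] at hn ⊢
      have : ∑ k ∈ Finset.univ.erase i, (x k - w k).natAbs =
          ∑ k ∈ Finset.univ.erase i, (x k - y k).natAbs :=
        Finset.sum_congr rfl fun k hk => by simp [hw, Finset.ne_of_mem_erase hk]
      rw [this]
      simp only [hw, Function.update_self]
      omega
    · have := piW_mul_Gm hd x hy
      rw [h0, mul_zero, eq_comm, add_eq_zero] at this
      have := ENNReal.tsum_eq_zero.1 this.2 w
      simpa [cU, hwU, hy, hadj] using this

/-- The folding map of `U_j` onto `U_{j+1}`, by the reflection `t ↦ -1 - t` in coordinate `i`. -/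
def fold {d : ℕ} (i : Fin d) (z : Fin d → ℤ) : Fin d → ℤ :=
  Function.update z i (max (z i) (-1 - z i))

lemma memU_fold {d : ℕ} (i : Fin d) {z : Fin d → ℤ} (hz : memU (i : ℕ) z) :
    memU ((i : ℕ) + 1) (fold i z) := by
  intro k hk
  by_cases hki : k = i
  · subst hki
    simp only [fold, Function.update_self]
    omega
  · have : (k : ℕ) ≠ i := fun h => hki (Fin.ext h)
    simpa [fold, hki] using hz k (by omega)

lemma fold_nbr {d : ℕ} (i : Fin d) (z : Fin d → ℤ) (p : Fin d × ℤˣ) :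
    fold i (nbr i z p) = nbr ((i : ℕ) + 1) (fold i z)
      (p.1, if p.1 = i ∧ z i < 0 then -p.2 else p.2) := by
  obtain ⟨k, s⟩ := p
  by_cases hki : k = i
  · subst hki
    ext l
    by_cases hl : l = k
    · subst hl
      rcases Int.units_eq_one_or s with rfl | rfl <;>
        by_cases hz : z l < 0 <;> simp [fold, nbr, hz] <;> omega
    · simp [fold, nbr, hl]
  · have hv : (k : ℕ) ≠ i := fun h => hki (Fin.ext h)
    have hlt : (k : ℕ) < i ↔ (k : ℕ) < (i : ℕ) + 1 := by omega
    simp only [fold, nbr, hki, Ne.symm hki, Function.update_of_ne, ne_eq, not_false_eq_true,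
      false_and, if_false, hlt]
    rw [Function.update_comm hki]

lemma sum_fold_nbr {d : ℕ} (i : Fin d) (z : Fin d → ℤ) (h : (Fin d → ℤ) → ℝ≥0∞) :
    ∑ p, h (fold i (nbr i z p)) = ∑ p, h (nbr ((i : ℕ) + 1) (fold i z) p) := by
  simp only [Fintype.sum_prod_type, fold_nbr]
  refine Finset.sum_congr rfl fun k _ => ?_
  split_ifs
  · exact Fintype.sum_equiv (Equiv.neg ℤˣ) _ _ fun _ => rfl
  · rfl

/-- The easy half of the reflection principle for passing from `U_j` to `U_{j+1}`. -/
lemma Gm_add_Gm_reflect_le {d : ℕ} (i : Fin d) {x y : Fin d → ℤ}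
    (hx : memU ((i : ℕ) + 1) x) (hy : memU ((i : ℕ) + 1) y) :
    Gm d i x y + Gm d i (Function.update x i (-1 - x i)) y ≤ Gm d (i + 1) x y := by
  have hd : 0 < d := i.pos
  have hxi := hx i (Nat.lt_succ_self _)
  have hyi := hy i (Nat.lt_succ_self _)
  have hxU : memU (i : ℕ) x := fun k hk => hx k (by omega)
  have hfy : fold i y = y := by
    rw [fold, max_eq_left (by omega), Function.update_eq_self]
  have := Gm_add_Gm_le hd hxU ((memU_update hxU i (-1 - x i)).2 fun h => (lt_irrefl _ h).elim)
    (fun z => Gm d (i + 1) x (fold i z)) (fun z hz => ?_) y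
  · simpa only [hfy] using this
  rw [sum_fold_nbr i z fun z => Gm d (i + 1) x z, ← sum_nbr_Gm hd x (memU_fold i hz)]
  refine add_le_add ?_ le_rfl
  by_cases h1 : x = z
  · subst h1
    have h2 : Function.update x i (-1 - x i) ≠ x := fun h => by
      have := congrFun h i
      simp at this
      omega
    have h3 : fold i x = x := by
      rw [fold, max_eq_left (by omega), Function.update_eq_self]
    simp [h2, h3]
  · by_cases h2 : Function.update x i (-1 - x i) = z
    · have h3 : fold i z = x := by
        subst h2
        have : max (-1 - x i) (-1 - (-1 - x i)) = x i := by omega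
        simp only [fold, Function.update_self, Function.update_idem, this,
          Function.update_eq_self]
      simp [h1, h2, h3]
    · simp [h1, h2]

lemma rpow_one_add_le {t : ℝ} (h1 : -(1 / 10) ≤ t) (h2 : t ≤ 1 / 10) :
    (1 + t) ^ (-(1 / 4) : ℝ) ≤ 1 - t / 4 + 3 / 16 * t ^ 2 := by
  have hq : 0 < 1 - t / 4 + 3 / 16 * t ^ 2 := by nlinarith [sq_nonneg t]
  have key : 1 ≤ (1 + t) * (1 - t / 4 + 3 / 16 * t ^ 2) ^ 4 := by
    have hpow : ∀ n : ℕ, -(1 / 10) ^ n ≤ t ^ n ∧ t ^ n ≤ (1 / 10) ^ n := fun n => by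
      rw [← abs_le, abs_pow]
      exact pow_le_pow_left₀ (abs_nonneg t) (abs_le.2 ⟨h1, h2⟩) n
    have hr : 0 ≤ 1 / 8 + 1 / 2 * t - 69 / 256 * t ^ 2 + 61 / 256 * t ^ 3 - 159 / 2048 * t ^ 4
        + 135 / 4096 * t ^ 5 - 351 / 65536 * t ^ 6 + 81 / 65536 * t ^ 7 := by
      linarith [(hpow 2).2, (hpow 3).1, (hpow 4).2, (hpow 5).1, (hpow 6).2, (hpow 7).1]
    linear_combination mul_nonneg (sq_nonneg t) hr
  have hp : (0 : ℝ) < 1 + t := by linarith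
  rw [Real.rpow_neg hp.le, inv_le_comm₀ (by positivity) hq]
  refine le_of_pow_le_pow_left₀ (n := 4) (by norm_num) (by positivity) ?_
  rw [← Real.rpow_natCast ((1 + t) ^ _), ← Real.rpow_mul hp.le, inv_pow]
  norm_num
  rw [inv_le_comm₀ (by positivity) hp, ← one_div, div_le_iff₀ hp]
  linarith

lemma one_add_inv_le_rpow {a : ℝ} (ha : 4 < a) :
    1 + 1 / a ≤ (1 - 4 / a) ^ (-(1 / 4) : ℝ) := by
  have ha0 : 0 < a := by linarith
  have hp : 0 < 1 - 4 / a := by rw [sub_pos, div_lt_one ha0]; exact ha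
  have h := rpow_one_add_le_one_add_mul_self (s := -(4 / a)) (p := 1 / 4) (by linarith)
    (by norm_num) (by norm_num)
  rw [← sub_eq_add_neg] at h
  have hu : 0 < 1 / a := by positivity
  have e : 1 + 1 / 4 * -(4 / a) = 1 - 1 / a := by ring
  rw [e] at h
  rw [Real.rpow_neg hp.le, le_inv_comm₀ (by positivity) (by positivity)]
  refine h.trans ?_
  rw [← one_div, le_div_iff₀ (by positivity)]
  nlinarith

/-- A quadratic form invariant under the reflections `t ↦ -1 - t` of the coordinates. -/
def quad {d : ℕ} (z : Fin d → ℤ) : ℝ := ∑ i, (2 * (z i : ℝ) + 1) ^ 2 + 400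

lemma quad_update {d : ℕ} (z : Fin d → ℤ) (i : Fin d) (a : ℤ) :
    quad (Function.update z i a) = quad z - (2 * (z i : ℝ) + 1) ^ 2 + (2 * (a : ℝ) + 1) ^ 2 := by
  unfold quad
  rw [← Finset.add_sum_erase _ _ (Finset.mem_univ i), ← Finset.add_sum_erase _
    (fun i => (2 * (z i : ℝ) + 1) ^ 2) (Finset.mem_univ i)]
  have : ∑ k ∈ Finset.univ.erase i, (2 * (Function.update z i a k : ℝ) + 1) ^ 2 =
      ∑ k ∈ Finset.univ.erase i, (2 * (z k : ℝ) + 1) ^ 2 :=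
    Finset.sum_congr rfl fun k hk => by simp [Finset.ne_of_mem_erase hk]
  rw [this]
  simp only [Function.update_self]
  ring

lemma quad_nbr {d m : ℕ} {z : Fin d → ℤ} (hz : memU m z) (p : Fin d × ℤˣ) :
    quad (nbr m z p) = quad z + 4 + 4 * ((p.2 : ℤ) : ℝ) * (2 * (z p.1 : ℝ) + 1) := by
  obtain ⟨i, s⟩ := p
  rw [nbr, quad_update]
  by_cases h : (i : ℕ) < m
  · have := hz i h
    rcases Int.units_eq_one_or s with rfl | rfl
    · rw [if_pos h, max_eq_left (by simp; omega)]
      push_cast; ring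
    · rcases this.eq_or_lt with h0 | h0
      · simp [← h0, h]
      · rw [if_pos h, max_eq_left (by simp; omega)]
        push_cast; ring
  · rw [if_neg h]
    rcases Int.units_eq_one_or s with rfl | rfl <;> push_cast <;> ring

/-- In dimension at least three `quad ^ (-1/4)` is strictly superharmonic on every `U_m`. -/
lemma sum_quad_rpow_lt {d m : ℕ} (hd : 3 ≤ d) {z : Fin d → ℤ} (hz : memU m z) :
    ∑ p, quad (nbr m z p) ^ (-(1 / 4) : ℝ) < 2 * d * quad z ^ (-(1 / 4) : ℝ) := by
  set S : ℝ := ∑ i, (2 * (z i : ℝ) + 1) ^ 2 with hS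
  set a : ℝ := quad z + 4 with ha
  have hSa : a = S + 404 := by rw [ha, quad]; ring
  have hS0 : 0 ≤ S := Finset.sum_nonneg fun _ _ => sq_nonneg _
  have ha0 : 0 < a := by linarith
  have hpair : ∀ i, ∑ s : ℤˣ, quad (nbr m z (i, s)) ^ (-(1 / 4) : ℝ) ≤
      a ^ (-(1 / 4) : ℝ) * (2 + 6 * (2 * (z i : ℝ) + 1) ^ 2 / a ^ 2) := by
    intro i
    set b : ℝ := 2 * (z i : ℝ) + 1 with hb
    have hbS : b ^ 2 ≤ S := Finset.single_le_sum
      (f := fun i => (2 * (z i : ℝ) + 1) ^ 2) (fun _ _ => sq_nonneg _) (Finset.mem_univ i)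
    have hlo : -(1 / 10) ≤ 4 * b / a := by
      rw [le_div_iff₀ ha0]; nlinarith [sq_nonneg (b + 20)]
    have hhi : 4 * b / a ≤ 1 / 10 := by
      rw [div_le_iff₀ ha0]; nlinarith [sq_nonneg (b - 20)]
    have e : ∀ t : ℝ, -(1 / 10) ≤ t → (a * (1 + t)) ^ (-(1 / 4) : ℝ) =
        a ^ (-(1 / 4) : ℝ) * (1 + t) ^ (-(1 / 4) : ℝ) := fun t ht =>
      Real.mul_rpow ha0.le (by linarith)
    have e1 : quad (nbr m z (i, 1)) = a * (1 + 4 * b / a) := by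
      rw [quad_nbr hz]; field_simp; simp [ha, hb]
    have e2 : quad (nbr m z (i, -1)) = a * (1 + -(4 * b / a)) := by
      rw [quad_nbr hz]; field_simp; simp [ha, hb]
    rw [UnitsInt.univ, Finset.sum_pair (by decide), e1, e2, e _ hlo, e _ (by linarith), ← mul_add]
    refine mul_le_mul_of_nonneg_left ?_ (by positivity)
    have h1 := rpow_one_add_le hlo hhi
    have h2 := rpow_one_add_le (t := -(4 * b / a)) (by linarith) (by linarith)
    have h3 : 6 * b ^ 2 / a ^ 2 = 3 / 8 * (4 * b / a) ^ 2 := by field_simp; ring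
    rw [h3]
    nlinarith
  have hc : 0 < a ^ (-(1 / 4) : ℝ) := by positivity
  calc ∑ p, quad (nbr m z p) ^ (-(1 / 4) : ℝ)
      ≤ ∑ i, a ^ (-(1 / 4) : ℝ) * (2 + 6 * (2 * (z i : ℝ) + 1) ^ 2 / a ^ 2) := by
        rw [Fintype.sum_prod_type]
        exact Finset.sum_le_sum fun i _ => hpair i
    _ = a ^ (-(1 / 4) : ℝ) * (2 * d + 6 * S / a ^ 2) := by
        rw [← Finset.mul_sum, Finset.sum_add_distrib, ← Finset.sum_div, ← Finset.mul_sum,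
          ← hS]
        simp [mul_comm]
    _ < a ^ (-(1 / 4) : ℝ) * (2 * d * (1 + 1 / a)) := by
        refine mul_lt_mul_of_pos_left ?_ hc
        have h1 : 6 * S / a ^ 2 < 6 / a := by
          rw [div_lt_div_iff₀ (by positivity) ha0]; nlinarith
        have h2 : 6 / a ≤ 2 * d / a := by
          have : (3 : ℝ) ≤ d := by exact_mod_cast hd
          gcongr; linarith
        have h3 : 2 * (d : ℝ) * (1 + 1 / a) = 2 * d + 2 * d / a := by ring
        linarith
    _ ≤ a ^ (-(1 / 4) : ℝ) * (2 * d * (1 - 4 / a) ^ (-(1 / 4) : ℝ)) := by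
        gcongr
        exact one_add_inv_le_rpow (by linarith)
    _ = 2 * d * quad z ^ (-(1 / 4) : ℝ) := by
        have : quad z = a * (1 - 4 / a) := by field_simp; rw [ha]; ring
        rw [this, Real.mul_rpow ha0.le]
        · ring
        · rw [sub_nonneg, div_le_one ha0]; linarith

lemma Gm_ne_top {d m : ℕ} (hd : 3 ≤ d) {x : Fin d → ℤ} (hx : memU m x) (y : Fin d → ℤ) :
    Gm d m x y ≠ ⊤ := by
  set f : (Fin d → ℤ) → ℝ := fun z => quad z ^ (-(1 / 4) : ℝ) with hf
  have hq : ∀ z : Fin d → ℤ, 0 ≤ quad z := fun z =>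
    add_nonneg (Finset.sum_nonneg fun _ _ => sq_nonneg _) (by norm_num)
  have hf0 : ∀ z, 0 ≤ f z := fun z => Real.rpow_nonneg (hq z) _
  have hsup : ∀ z, memU m z → ∑ p, f (nbr m z p) < 2 * d * f z := fun z hz =>
    sum_quad_rpow_lt hd hz
  set ε := 2 * d * f x - ∑ p, f (nbr m x p) with hε
  have hε0 : 0 < ε := sub_pos.2 (hsup x hx)
  set C := 2 / ε with hC
  have hC0 : 0 < C := by positivity
  have := Gm_add_Gm_le (by omega) hx hx (fun z => ENNReal.ofReal (C * f z)) (fun z hz => ?_) y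
  · exact ne_top_of_le_ne_top ENNReal.ofReal_ne_top (le_self_add.trans this)
  have hR : (if x = z then (2 : ℝ) else 0) + ∑ p, C * f (nbr m z p) ≤ 2 * d * (C * f z) := by
    rw [← Finset.mul_sum]
    by_cases hxz : x = z
    · subst hxz
      have : C * ε = 2 := by rw [hC]; field_simp
      rw [if_pos rfl]
      nlinarith
    · rw [if_neg hxz]
      nlinarith [hsup z hz]
  have h1 : (if x = z then (1 : ℝ≥0∞) else 0) + (if x = z then 1 else 0) =
      ENNReal.ofReal (if x = z then 2 else 0) := by
    split_ifs
    · norm_num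
    · simp
  have h2 : (2 * d * ENNReal.ofReal (C * f z) : ℝ≥0∞) = ENNReal.ofReal (2 * d * (C * f z)) := by
    rw [ENNReal.ofReal_mul (p := 2 * (d : ℝ)) (by positivity), ENNReal.ofReal_mul (p := 2) (by norm_num)]
    simp
  rw [h1, h2, ← ENNReal.ofReal_sum_of_nonneg fun p _ => mul_nonneg hC0.le (hf0 _),
    ← ENNReal.ofReal_add (by split_ifs <;> norm_num)
      (Finset.sum_nonneg fun p _ => mul_nonneg hC0.le (hf0 _))]
  exact ENNReal.ofReal_le_ofReal hR

/-- For `d ≥ 3` and `0 ≤ j ≤ d-1`, the strict inequality `G_j(x,y) < G_{j+1}(x,y)` holds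
for all `x, y ∈ U_{j+1} = ℕ₀^{j+1} × ℤ^{d-j-1}` (so that, in particular, for `x, y` in
the orthant `O = ℕ₀^d` one has the strict chain
`g(x,y) < G_1(x,y) < … < G_d(x,y) = G_O(x,y)`). -/
theorem green_Um_strict_chain (d : ℕ) (hd : 3 ≤ d) (j : ℕ) (hj : j < d)
    (x y : Fin d → ℤ) (hx : memU (j + 1) x) (hy : memU (j + 1) y) :
    Gm d j x y < Gm d (j + 1) x y := by
  have hxU : memU j x := fun k hk => hx k (by omega)
  have hyU : memU j y := fun k hk => hy k (by omega)
  have hx' : memU j (Function.update x ⟨j, hj⟩ (-1 - x ⟨j, hj⟩)) :=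
    (memU_update hxU _ _).2 fun h => (lt_irrefl _ h).elim
  exact (ENNReal.lt_add_right (Gm_ne_top hd hxU y) (Gm_ne_zero (by omega) hx' _ y hyU rfl)).trans_le
    (Gm_add_Gm_reflect_le ⟨j, hj⟩ hx hy)

end
end

section
/- For all real x ≥ 0 and integers d' ≥ d ≥ 1, ( I₀(x/d) + I₁(x/d) )^d ≥ ( I₀(x/d') + I₁(x/d') )^{d'}, where I₀ and I₁ are the modified Bessel functions of the first kind of orders 0 and 1. Equivalently, using the representation I₀(t) + I₁(t) = ∫_0^π e^{t cos θ} (cos θ + 1)/π dθ, the function d ↦ ( ∫_0^π e^{(x/d) cos θ} (cos θ + 1)/π dθ )^d is nonincreasing in d. -/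
noncomputable section

/-- The modified Bessel function of the first kind of integer order `k ≥ 0`:
`I_k(t) = (1/π) ∫_0^π e^{t cos θ} cos(kθ) dθ`. -/
def besselI (k : ℕ) (t : ℝ) : ℝ :=
  (1 / Real.pi) * ∫ θ in (0 : ℝ)..Real.pi, Real.exp (t * Real.cos θ) * Real.cos (k * θ)

open MeasureTheory ProbabilityTheory

/-- Jensen's inequality for moment generating functions. -/
theorem mgf_rpow_le_mgf_mul {Ω : Type*} [MeasurableSpace Ω] {μ : Measure Ω}
    [IsProbabilityMeasure μ] {X : Ω → ℝ} {r s : ℝ} (hr : 1 ≤ r)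
    (hs : Integrable (fun ω => Real.exp (s * X ω)) μ)
    (hrs : Integrable (fun ω => Real.exp (r * s * X ω)) μ) :
    mgf X μ s ^ r ≤ mgf X μ (r * s) := by
  have key : ∀ ω, Real.exp (s * X ω) ^ r = Real.exp (r * s * X ω) := fun ω => by
    rw [← Real.exp_mul]
    ring_nf
  have hJensen := (convexOn_rpow hr).map_integral_le (μ := μ)
    (f := fun ω => Real.exp (s * X ω))
    (Real.continuous_rpow_const (by linarith)).continuousOn isClosed_Ici
    (ae_of_all _ fun ω => (Real.exp_pos _).le) hs (by simpa only [Function.comp_def, key] using hrs)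
  simpa only [mgf, key] using hJensen

/-- The measure on `(0, π]` with density `(cos θ + 1) / π`. -/
def besselMeasure : Measure ℝ :=
  (volume.restrict (Set.Ioc 0 Real.pi)).withDensity
    fun θ => ENNReal.ofReal ((Real.cos θ + 1) / Real.pi)

theorem cos_add_one_div_pi_nonneg (θ : ℝ) : 0 ≤ (Real.cos θ + 1) / Real.pi :=
  div_nonneg (by linarith [Real.neg_one_le_cos θ]) Real.pi_pos.le

instance : IsProbabilityMeasure besselMeasure where
  measure_univ := by
    rw [besselMeasure, withDensity_apply _ MeasurableSet.univ, Measure.restrict_univ,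
      ← ofReal_integral_eq_lintegral_ofReal
        (Continuous.integrableOn_Ioc (by fun_prop)) (ae_of_all _ cos_add_one_div_pi_nonneg),
      ← intervalIntegral.integral_of_le Real.pi_pos.le, intervalIntegral.integral_div,
      intervalIntegral.integral_add (Real.continuous_cos.intervalIntegrable _ _)
        (continuous_const.intervalIntegrable _ _)]
    simp [Real.pi_ne_zero]

theorem integrable_exp_mul_cos_besselMeasure (t : ℝ) :
    Integrable (fun θ => Real.exp (t * Real.cos θ)) besselMeasure := by
  refine Integrable.of_bound (C := Real.exp |t|)
    (Continuous.aestronglyMeasurable (by fun_prop)) (ae_of_all _ fun θ => ?_)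
  rw [Real.norm_eq_abs, Real.abs_exp, Real.exp_le_exp]
  calc t * Real.cos θ ≤ |t| * |Real.cos θ| := by
        rw [← abs_mul]
        exact le_abs_self _
    _ ≤ |t| := mul_le_of_le_one_right (abs_nonneg t) (Real.abs_cos_le_one θ)

theorem besselI_zero_add_besselI_one (t : ℝ) :
    besselI 0 t + besselI 1 t = mgf Real.cos besselMeasure t := by
  rw [mgf, besselMeasure, integral_withDensity_eq_integral_toReal_smul (by fun_prop)
    (ae_of_all _ fun θ => ENNReal.ofReal_lt_top), ← intervalIntegral.integral_of_le Real.pi_pos.le,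
    besselI, besselI, ← mul_add, ← intervalIntegral.integral_add
      (Continuous.intervalIntegrable (by fun_prop) _ _)
      (Continuous.intervalIntegrable (by fun_prop) _ _),
    ← intervalIntegral.integral_const_mul]
  congr 1 with θ
  rw [ENNReal.toReal_ofReal (cos_add_one_div_pi_nonneg θ), smul_eq_mul]
  simp only [Nat.cast_zero, Nat.cast_one, zero_mul, one_mul, Real.cos_zero]
  ring

/-- For all real `x ≥ 0` and integers `d' ≥ d ≥ 1`,
`(I₀(x/d) + I₁(x/d))^d ≥ (I₀(x/d') + I₁(x/d'))^{d'}`; i.e. the function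
`d ↦ (I₀(x/d) + I₁(x/d))^d` is nonincreasing in `d`. -/
theorem bessel_pow_antitone (x : ℝ) (hx : 0 ≤ x) (d d' : ℕ) (hd : 1 ≤ d) (hdd' : d ≤ d') :
    (besselI 0 (x / d') + besselI 1 (x / d')) ^ d'
      ≤ (besselI 0 (x / d) + besselI 1 (x / d)) ^ d := by
  simp only [besselI_zero_add_besselI_one]
  have hd0 : (0 : ℝ) < d := by exact_mod_cast hd
  have hd'0 : (0 : ℝ) < d' := by exact_mod_cast hd.trans hdd'
  have hr : (1 : ℝ) ≤ d' / d := (one_le_div hd0).2 (by exact_mod_cast hdd')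
  have hJensen := mgf_rpow_le_mgf_mul (s := x / d') hr
    (integrable_exp_mul_cos_besselMeasure _) (integrable_exp_mul_cos_besselMeasure _)
  rw [show (d' : ℝ) / d * (x / d') = x / d by field_simp] at hJensen
  have hpow := pow_le_pow_left₀ (Real.rpow_nonneg mgf_nonneg _) hJensen d
  rwa [← Real.rpow_mul_natCast mgf_nonneg, div_mul_cancel₀ _ hd0.ne', Real.rpow_natCast] at hpow

end
end
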